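/- For every integer n ≥ 1, the number of sum-difference-balanced subsets S of {0, 1, ..., n−1} is at least (2×10⁻⁵)·2^n. -/

import Mathlib

open Finset Pointwise

/-- A family of subsets of `M` avoiding `T` and containing none of the disjoint pairs `{i, f i}`,
`i ∈ P`, has density at most `(1 / 2) ^ #T * (3 / 4) ^ #P` among all subsets of `M`. -/
theorem card_le_of_avoids {α : Type*} [DecidableEq α] {T : Finset α} {f : α → α} (P : Finset α)
    (hf : Set.InjOn f P) (hPT : ∀ i ∈ P, i ∉ T ∧ f i ∉ T) (hPP : ∀ i ∈ P, f i ∉ P)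
    (M : Finset α) (hTM : T ⊆ M) (hPM : ∀ i ∈ P, i ∈ M ∧ f i ∈ M)
    (F : Finset (Finset α)) (hFM : ∀ A ∈ F, A ⊆ M) (hFT : ∀ A ∈ F, ∀ t ∈ T, t ∉ A)
    (hFP : ∀ A ∈ F, ∀ i ∈ P, i ∈ A → f i ∉ A) :
    (F.card : ℝ) ≤ 2 ^ M.card * (1 / 2) ^ T.card * (3 / 4) ^ P.card := by
  induction P using Finset.induction_on generalizing M F with
  | empty =>
    have hsub : F ⊆ (M \ T).powerset := fun A hA =>
      mem_powerset.2 fun x hx => mem_sdiff.2 ⟨hFM A hA hx, fun hxT => hFT A hA x hxT hx⟩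
    have hcard := card_le_card hsub
    rw [card_powerset] at hcard
    have hM : M.card = (M \ T).card + T.card := (card_sdiff_add_card_eq_card hTM).symm
    calc (F.card : ℝ) ≤ 2 ^ (M \ T).card := by exact_mod_cast hcard
      _ = 2 ^ M.card * (1 / 2) ^ T.card * (3 / 4) ^ (∅ : Finset α).card := by
        rw [hM, pow_add, mul_assoc (2 ^ _), ← mul_pow]
        norm_num
  | insert a P ha ih =>
    have haT := hPT a (mem_insert_self a P)
    have haM := hPM a (mem_insert_self a P)
    have hfa : f a ≠ a := fun h =>
      hPP a (mem_insert_self a P) (h.symm ▸ mem_insert_self a P)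
    have hfaP : f a ∉ P := fun h => hPP a (mem_insert_self a P) (mem_insert_of_mem h)
    set D : Finset α := {a, f a} with hD
    have hDM : D ⊆ M := by
      intro x hx
      rcases mem_insert.1 hx with rfl | hx
      · exact haM.1
      · exact mem_singleton.1 hx ▸ haM.2
    have hDcard : D.card = 2 := card_pair hfa.symm
    set G := F.image fun A => A \ D with hG
    have hGcard : (G.card : ℝ) ≤ 2 ^ (M \ D).card * (1 / 2) ^ T.card * (3 / 4) ^ P.card := by
      apply ih
      · exact hf.mono (by simp)
      · exact fun i hi => hPT i (mem_insert_of_mem hi)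
      · exact fun i hi h => hPP i (mem_insert_of_mem hi) (mem_insert_of_mem h)
      · intro t ht
        simp only [hD, mem_sdiff, mem_insert, mem_singleton, not_or]
        exact ⟨hTM ht, fun h => haT.1 (h ▸ ht), fun h => haT.2 (h ▸ ht)⟩
      · intro i hi
        have hi' := mem_insert_of_mem (a := i) (b := a) hi
        simp only [hD, mem_sdiff, mem_insert, mem_singleton, not_or]
        refine ⟨⟨(hPM i hi').1, fun h => ha (h ▸ hi), fun h => hfaP (h ▸ hi)⟩,
          (hPM i hi').2, fun h => hPP i hi' (h ▸ mem_insert_self a P), fun h => ?_⟩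
        exact ha (hf hi' (mem_insert_self a P) h ▸ hi)
      · intro B hB
        obtain ⟨A, hA, rfl⟩ := mem_image.1 hB
        exact sdiff_subset_sdiff (hFM A hA) subset_rfl
      · intro B hB t ht
        obtain ⟨A, hA, rfl⟩ := mem_image.1 hB
        exact fun h => hFT A hA t ht (mem_sdiff.1 h).1
      · intro B hB i hi hiB
        obtain ⟨A, hA, rfl⟩ := mem_image.1 hB
        exact fun h => hFP A hA i (mem_insert_of_mem hi) (mem_sdiff.1 hiB).1 (mem_sdiff.1 h).1
    have hFG : F.card ≤ (G ×ˢ ({∅, {a}, {f a}} : Finset (Finset α))).card := by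
      apply card_le_card_of_injOn fun A => (A \ D, A ∩ D)
      · intro A hA
        refine mem_product.2 ⟨mem_image_of_mem _ hA, ?_⟩
        have hnot := hFP A hA a (mem_insert_self a P)
        simp only [mem_insert, mem_singleton]
        by_cases h1 : a ∈ A
        · refine Or.inr (Or.inl ?_)
          rw [hD, inter_insert_of_mem h1, inter_singleton_of_notMem (hnot h1)]
          rfl
        · rw [hD, inter_insert_of_notMem h1]
          by_cases h2 : f a ∈ A
          · exact Or.inr (Or.inr (inter_singleton_of_mem h2))
          · exact Or.inl (inter_singleton_of_notMem h2)
      · intro A _ B _ h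
        have h := Prod.mk.inj h
        rw [← sdiff_union_inter A D, ← sdiff_union_inter B D, h.1, h.2]
    have hFG' : (F.card : ℝ) ≤ G.card * 3 := by
      rw [card_product] at hFG
      exact_mod_cast hFG.trans (Nat.mul_le_mul_left _ card_le_three)
    have hM : M.card = (M \ D).card + 2 := by
      rw [← hDcard, card_sdiff_add_card_eq_card hDM]
    rw [card_insert_of_notMem ha, hM, pow_add, pow_succ (3 / 4 : ℝ)]
    linarith

/-- The set obtained from a subset `A` of the middle part of `{0, …, n - 1}` by adjoining
the seven smallest and the seven largest elements. -/
noncomputable def withFringes (n : ℕ) (A : Finset ℤ) : Finset ℤ :=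
  A ∪ Ico 0 7 ∪ Ico (n - 7 : ℤ) n

theorem mem_withFringes {n : ℕ} {A : Finset ℤ} {x : ℤ} :
    x ∈ withFringes n A ↔ x ∈ A ∨ (0 ≤ x ∧ x < 7) ∨ ((n : ℤ) - 7 ≤ x ∧ x < n) := by
  simp [withFringes]

theorem withFringes_injOn (n : ℕ) :
    Set.InjOn (withFringes n) ((Ico (7 : ℤ) (n - 7)).powerset : Set (Finset ℤ)) := by
  intro A hA B hB h
  have hA := mem_powerset.1 hA
  have hB := mem_powerset.1 hB
  ext x
  have hx : x ∈ withFringes n A ↔ x ∈ withFringes n B := by rw [h]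
  rw [mem_withFringes, mem_withFringes] at hx
  constructor
  · intro hxA
    have := mem_Ico.1 (hA hxA)
    rcases hx.1 (Or.inl hxA) with h | h | h
    · exact h
    · omega
    · omega
  · intro hxB
    have := mem_Ico.1 (hB hxB)
    rcases hx.2 (Or.inl hxB) with h | h | h
    · exact h
    · omega
    · omega

theorem withFringes_subset {n : ℕ} (hn : 14 ≤ n) {A : Finset ℤ} (hA : A ⊆ Ico (7 : ℤ) (n - 7)) :
    withFringes n A ⊆ Icc (0 : ℤ) (n - 1) := by
  intro x hx
  rw [mem_Icc]
  rcases mem_withFringes.1 hx with h | h | h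
  · have := mem_Ico.1 (hA h)
    omega
  · omega
  · omega

/-- The subsets of the middle part whose fringed extension misses the sum `k`. -/
noncomputable def missingSum (n : ℕ) (k : ℤ) : Finset (Finset ℤ) :=
  (Ico (7 : ℤ) (n - 7)).powerset.filter fun A => k ∉ withFringes n A + withFringes n A

/-- The subsets of the middle part whose fringed extension misses the difference `d`. -/
noncomputable def missingDiff (n : ℕ) (d : ℤ) : Finset (Finset ℤ) :=
  (Ico (7 : ℤ) (n - 7)).powerset.filter fun A => d ∉ withFringes n A - withFringes n A

theorem card_missingSum_low {n j : ℕ} (hn : 14 ≤ n) (hj : j < n - 20) :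
    ((missingSum n (13 + j)).card : ℝ) ≤ 2 ^ (n - 14) * (1 / 128) * (3 / 4) ^ (j / 2) := by
  have key := card_le_of_avoids (T := Ico (7 + j : ℤ) (14 + j)) (f := fun i => 13 + j - i)
    (Ico (7 : ℤ) (7 + (j / 2 : ℕ))) (fun x _ y _ h => by simp only at h; omega)
    (fun i hi => by simp only [mem_Ico] at *; omega)
    (fun i hi => by simp only [mem_Ico] at *; omega)
    (Ico (7 : ℤ) (n - 7)) (fun t ht => by simp only [mem_Ico] at *; omega)
    (fun i hi => by simp only [mem_Ico] at *; omega) (missingSum n (13 + j))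
    (fun A hA => mem_powerset.1 (mem_filter.1 hA).1)
    (fun A hA t ht h => (mem_filter.1 hA).2 <| mem_add.2
      ⟨t, mem_withFringes.2 (Or.inl h), 13 + j - t,
        mem_withFringes.2 (by simp only [mem_Ico] at ht; omega), by ring⟩)
    (fun A hA i _ h h' => (mem_filter.1 hA).2 <| mem_add.2
      ⟨i, mem_withFringes.2 (Or.inl h), _, mem_withFringes.2 (Or.inl h'), by ring⟩)
  simp only [Int.card_Ico] at key
  convert key using 3
  · congr 1
    omega
  · rw [show ((14 + j : ℤ) - (7 + j)).toNat = 7 by omega]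
    norm_num
  · omega

theorem card_missingSum_high {n j : ℕ} (hn : 14 ≤ n) (hj : j < n - 20) :
    ((missingSum n (2 * n - 15 - j)).card : ℝ) ≤
      2 ^ (n - 14) * (1 / 128) * (3 / 4) ^ (j / 2) := by
  have key := card_le_of_avoids (T := Ico (n - 14 - j : ℤ) (n - 7 - j))
    (f := fun i => 2 * n - 15 - j - i)
    (Ico (n - 7 - (j / 2 : ℕ) : ℤ) (n - 7)) (fun x _ y _ h => by simp only at h; omega)
    (fun i hi => by simp only [mem_Ico] at *; omega)
    (fun i hi => by simp only [mem_Ico] at *; omega)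
    (Ico (7 : ℤ) (n - 7)) (fun t ht => by simp only [mem_Ico] at *; omega)
    (fun i hi => by simp only [mem_Ico] at *; omega) (missingSum n (2 * n - 15 - j))
    (fun A hA => mem_powerset.1 (mem_filter.1 hA).1)
    (fun A hA t ht h => (mem_filter.1 hA).2 <| mem_add.2
      ⟨t, mem_withFringes.2 (Or.inl h), 2 * n - 15 - j - t,
        mem_withFringes.2 (by simp only [mem_Ico] at ht; omega), by ring⟩)
    (fun A hA i _ h h' => (mem_filter.1 hA).2 <| mem_add.2
      ⟨i, mem_withFringes.2 (Or.inl h), _, mem_withFringes.2 (Or.inl h'), by ring⟩)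
  simp only [Int.card_Ico] at key
  convert key using 3
  · congr 1
    omega
  · rw [show ((n - 7 - j : ℤ) - (n - 14 - j)).toNat = 7 by omega]
    norm_num
  · omega

theorem card_missingDiff {n j : ℕ} (hn : 14 ≤ n) (hj : j < n - 20) :
    ((missingDiff n (7 + j)).card : ℝ) ≤
      2 ^ (n - 14) * (1 / 128) * (3 / 4) ^ min j (n - 20 - 1 - j) := by
  have key := card_le_of_avoids (T := Ico (7 + j : ℤ) (14 + j)) (f := fun i => i + (7 + j))
    (Ico (7 : ℤ) (7 + (min j (n - 20 - 1 - j) : ℕ))) (fun x _ y _ h => by simp only at h; omega)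
    (fun i hi => by simp only [mem_Ico] at *; omega)
    (fun i hi => by simp only [mem_Ico] at *; omega)
    (Ico (7 : ℤ) (n - 7)) (fun t ht => by simp only [mem_Ico] at *; omega)
    (fun i hi => by simp only [mem_Ico] at *; omega) (missingDiff n (7 + j))
    (fun A hA => mem_powerset.1 (mem_filter.1 hA).1)
    (fun A hA t ht h => (mem_filter.1 hA).2 <| mem_sub.2
      ⟨t, mem_withFringes.2 (Or.inl h), t - (7 + j),
        mem_withFringes.2 (by simp only [mem_Ico] at ht; omega), by ring⟩)
    (fun A hA i _ h h' => (mem_filter.1 hA).2 <| mem_sub.2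
      ⟨_, mem_withFringes.2 (Or.inl h'), i, mem_withFringes.2 (Or.inl h), by ring⟩)
  simp only [Int.card_Ico] at key
  convert key using 3
  · congr 1
    omega
  · rw [show ((14 + j : ℤ) - (7 + j)).toNat = 7 by omega]
    norm_num
  · omega

theorem sum_pow_three_quarters_le (N : ℕ) : ∑ j ∈ range N, (3 / 4 : ℝ) ^ j ≤ 4 := by
  rw [geom_sum_eq (by norm_num)]
  have : (0 : ℝ) ≤ (3 / 4) ^ N := by positivity
  norm_num
  linarith

theorem sum_pow_half_three_quarters_le (N : ℕ) :
    ∑ j ∈ range N, (3 / 4 : ℝ) ^ (j / 2) ≤ 8 := by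
  have hdouble : ∀ K : ℕ, ∑ j ∈ range (2 * K), (3 / 4 : ℝ) ^ (j / 2) =
      2 * ∑ j ∈ range K, (3 / 4 : ℝ) ^ j := by
    intro K
    induction K with
    | zero => simp
    | succ K ih =>
      rw [show 2 * (K + 1) = 2 * K + 1 + 1 by ring, sum_range_succ, sum_range_succ, ih,
        sum_range_succ, show (2 * K + 1) / 2 = K by omega, show 2 * K / 2 = K by omega]
      ring
  calc ∑ j ∈ range N, (3 / 4 : ℝ) ^ (j / 2)
      ≤ ∑ j ∈ range (2 * N), (3 / 4 : ℝ) ^ (j / 2) :=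
        sum_le_sum_of_subset_of_nonneg (range_mono (by omega)) fun _ _ _ => by positivity
    _ ≤ 8 := by
        rw [hdouble]
        linarith [sum_pow_three_quarters_le N]

theorem sum_pow_min_three_quarters_le (N : ℕ) :
    ∑ j ∈ range N, (3 / 4 : ℝ) ^ min j (N - 1 - j) ≤ 8 := by
  calc ∑ j ∈ range N, (3 / 4 : ℝ) ^ min j (N - 1 - j)
      ≤ ∑ j ∈ range N, ((3 / 4 : ℝ) ^ j + (3 / 4 : ℝ) ^ (N - 1 - j)) := by
        refine sum_le_sum fun j _ => ?_
        rcases min_choice j (N - 1 - j) with h | h <;> rw [h]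
        · exact le_add_of_nonneg_right (by positivity)
        · exact le_add_of_nonneg_left (by positivity)
    _ ≤ 8 := by
        rw [sum_add_distrib, sum_range_reflect (fun j => (3 / 4 : ℝ) ^ j)]
        linarith [sum_pow_three_quarters_le N]

/-- The subsets of the middle part whose fringed extension misses some sum or difference
that is not already provided by the fringes. -/
noncomputable def missingSome (n : ℕ) : Finset (Finset ℤ) :=
  (range (n - 20)).biUnion fun j =>
    missingSum n (13 + j) ∪ missingSum n (2 * n - 15 - j) ∪ missingDiff n (7 + j)

theorem card_missingSome_le {n : ℕ} (hn : 14 ≤ n) :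
    ((missingSome n).card : ℝ) ≤ 2 ^ (n - 14) * (3 / 16) := by
  have hcard : (missingSome n).card ≤ ∑ j ∈ range (n - 20), ((missingSum n (13 + j)).card +
      (missingSum n (2 * n - 15 - j)).card + (missingDiff n (7 + j)).card) :=
    card_biUnion_le.trans <| sum_le_sum fun j _ =>
      (card_union_le _ _).trans (Nat.add_le_add_right (card_union_le _ _) _)
  calc ((missingSome n).card : ℝ)
      ≤ ∑ j ∈ range (n - 20), (((missingSum n (13 + j)).card : ℝ) +
        (missingSum n (2 * n - 15 - j)).card + (missingDiff n (7 + j)).card) := by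
        exact_mod_cast hcard
    _ ≤ ∑ j ∈ range (n - 20), (2 ^ (n - 14) * (1 / 128) *
        ((3 / 4) ^ (j / 2) + (3 / 4) ^ (j / 2) + (3 / 4) ^ min j (n - 20 - 1 - j)) : ℝ) := by
        refine sum_le_sum fun j hj => ?_
        have hj := mem_range.1 hj
        linarith [card_missingSum_low hn hj, card_missingSum_high hn hj, card_missingDiff hn hj]
    _ ≤ 2 ^ (n - 14) * (1 / 128) * (8 + 8 + 8) := by
        rw [← mul_sum, sum_add_distrib, sum_add_distrib]
        gcongr
        · exact sum_pow_half_three_quarters_le _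
        · exact sum_pow_half_three_quarters_le _
        · exact sum_pow_min_three_quarters_le _
    _ = 2 ^ (n - 14) * (3 / 16) := by ring

theorem withFringes_add_self {n : ℕ} (hn : 14 ≤ n) {A : Finset ℤ}
    (hA : A ⊆ Ico (7 : ℤ) (n - 7)) (hmiss : A ∉ missingSome n) :
    withFringes n A + withFringes n A = Icc (0 : ℤ) (2 * n - 2) := by
  have hsub := withFringes_subset hn hA
  have of_fringe : ∀ a b : ℤ, (0 ≤ a ∧ a < 7) ∨ ((n : ℤ) - 7 ≤ a ∧ a < n) →
      (0 ≤ b ∧ b < 7) ∨ ((n : ℤ) - 7 ≤ b ∧ b < n) →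
      a + b ∈ withFringes n A + withFringes n A := fun a b ha hb =>
    add_mem_add (mem_withFringes.2 (Or.inr ha)) (mem_withFringes.2 (Or.inr hb))
  ext x
  constructor
  · intro hx
    obtain ⟨a, ha, b, hb, rfl⟩ := mem_add.1 hx
    have := mem_Icc.1 (hsub ha)
    have := mem_Icc.1 (hsub hb)
    rw [mem_Icc]
    omega
  · intro hx
    rw [mem_Icc] at hx
    by_contra hxS
    have hmid : A ∈ missingSum n x := mem_filter.2 ⟨mem_powerset.2 hA, hxS⟩
    have hcase : x ≤ 12 ∨ (13 ≤ x ∧ x ≤ n - 8) ∨ (n - 7 ≤ x ∧ x ≤ n - 1) ∨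
        (n ≤ x ∧ x ≤ n + 5) ∨ (n + 6 ≤ x ∧ x ≤ 2 * n - 15) ∨ 2 * n - 14 ≤ x := by omega
    rcases hcase with h | h | h | h | h | h
    · exact hxS (by simpa using of_fringe (min x 6) (x - min x 6) (by omega) (by omega))
    · refine hmiss (mem_biUnion.2 ⟨(x - 13).toNat, mem_range.2 (by omega), ?_⟩)
      rw [show (13 + ((x - 13).toNat : ℤ)) = x by omega]
      exact mem_union_left _ (mem_union_left _ hmid)
    · exact hxS (by simpa using of_fringe 0 x (by omega) (by omega))
    · exact hxS (by simpa using of_fringe (n - 1) (x - (n - 1)) (by omega) (by omega))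
    · refine hmiss (mem_biUnion.2 ⟨(2 * n - 15 - x).toNat, mem_range.2 (by omega), ?_⟩)
      rw [show (2 * n - 15 - ((2 * n - 15 - x).toNat : ℤ)) = x by omega]
      exact mem_union_left _ (mem_union_right _ hmid)
    · exact hxS (by
        simpa using of_fringe (max (x - (n - 1)) (n - 7)) (x - max (x - (n - 1)) (n - 7))
          (by omega) (by omega))

theorem withFringes_sub_self {n : ℕ} (hn : 14 ≤ n) {A : Finset ℤ}
    (hA : A ⊆ Ico (7 : ℤ) (n - 7)) (hmiss : A ∉ missingSome n) :
    withFringes n A - withFringes n A = Icc (-(n - 1) : ℤ) (n - 1) := by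
  have hsub := withFringes_subset hn hA
  have of_fringe : ∀ a b : ℤ, (0 ≤ a ∧ a < 7) ∨ ((n : ℤ) - 7 ≤ a ∧ a < n) →
      (0 ≤ b ∧ b < 7) ∨ ((n : ℤ) - 7 ≤ b ∧ b < n) →
      a - b ∈ withFringes n A - withFringes n A := fun a b ha hb =>
    sub_mem_sub (mem_withFringes.2 (Or.inr ha)) (mem_withFringes.2 (Or.inr hb))
  have nonneg_mem : ∀ x : ℤ, 0 ≤ x → x ≤ n - 1 → x ∈ withFringes n A - withFringes n A := by
    intro x hx0 hx
    by_contra hxS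
    have hcase : x ≤ 6 ∨ (7 ≤ x ∧ x ≤ n - 14) ∨ n - 13 ≤ x := by omega
    rcases hcase with h | h | h
    · exact hxS (by simpa using of_fringe x 0 (by omega) (by omega))
    · refine hmiss (mem_biUnion.2 ⟨(x - 7).toNat, mem_range.2 (by omega), ?_⟩)
      rw [show (7 + ((x - 7).toNat : ℤ)) = x by omega]
      exact mem_union_right _ (mem_filter.2 ⟨mem_powerset.2 hA, hxS⟩)
    · exact hxS (by
        simpa using of_fringe (max x (n - 7)) (max x (n - 7) - x) (by omega) (by omega))
  ext x
  constructor
  · intro hx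
    obtain ⟨a, ha, b, hb, rfl⟩ := mem_sub.1 hx
    have := mem_Icc.1 (hsub ha)
    have := mem_Icc.1 (hsub hb)
    rw [mem_Icc]
    omega
  · intro hx
    rw [mem_Icc] at hx
    rcases le_total 0 x with h | h
    · exact nonneg_mem x h hx.2
    · obtain ⟨a, ha, b, hb, hab⟩ := mem_sub.1 (nonneg_mem (-x) (by omega) (by omega))
      exact mem_sub.2 ⟨b, hb, a, ha, by omega⟩

theorem many_sum_difference_balanced_sets (n : ℕ) (hn : 1 ≤ n) :
    (((Finset.Icc (0 : ℤ) (n - 1)).powerset.filter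
        (fun S : Finset ℤ => (S + S).card = (S - S).card)).card : ℝ)
      ≥ (2 / 10 ^ 5) * 2 ^ n := by
  rcases le_or_gt n 14 with hsmall | hlarge
  · have hpos : 1 ≤ ((Finset.Icc (0 : ℤ) (n - 1)).powerset.filter
        (fun S : Finset ℤ => (S + S).card = (S - S).card)).card :=
      card_pos.2 ⟨∅, by simp⟩
    calc (2 / 10 ^ 5 : ℝ) * 2 ^ n ≤ (2 / 10 ^ 5) * 2 ^ 14 := by
          gcongr
          norm_num
      _ ≤ 1 := by norm_num
      _ ≤ _ := by exact_mod_cast hpos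
  · have h14 : 14 ≤ n := hlarge.le
    set M := (Ico (7 : ℤ) (n - 7)).powerset with hM
    have hMcard : M.card = 2 ^ (n - 14) := by
      rw [hM, card_powerset, Int.card_Ico]
      congr 1
      omega
    have hgood : (M \ missingSome n).card ≤ ((Finset.Icc (0 : ℤ) (n - 1)).powerset.filter
        (fun S : Finset ℤ => (S + S).card = (S - S).card)).card := by
      refine card_le_card_of_injOn (withFringes n) ?_ ((withFringes_injOn n).mono ?_)
      · intro A hA
        obtain ⟨hAM, hmiss⟩ := mem_sdiff.1 hA
        have hAM := mem_powerset.1 hAM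
        refine mem_filter.2 ⟨mem_powerset.2 (withFringes_subset h14 hAM), ?_⟩
        rw [withFringes_add_self h14 hAM hmiss, withFringes_sub_self h14 hAM hmiss,
          Int.card_Icc, Int.card_Icc]
        omega
      · exact_mod_cast sdiff_subset
    have hdiff : M.card ≤ (missingSome n).card + (M \ missingSome n).card := by
      have := le_card_sdiff (missingSome n) M
      omega
    have hdiff' : (2 : ℝ) ^ (n - 14) ≤ (missingSome n).card + (M \ missingSome n).card := by
      rw [hMcard] at hdiff
      exact_mod_cast hdiff
    have hgood' : ((M \ missingSome n).card : ℝ) ≤ ((Finset.Icc (0 : ℤ) (n - 1)).powerset.filter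
        (fun S : Finset ℤ => (S + S).card = (S - S).card)).card := by
      exact_mod_cast hgood
    have hpow : (2 : ℝ) ^ n = 2 ^ (n - 14) * 2 ^ 14 := by
      rw [← pow_add]
      congr 1
      omega
    have hpos : (0 : ℝ) ≤ 2 ^ (n - 14) := by positivity
    rw [hpow, ge_iff_le]
    linarith [card_missingSome_le h14]
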